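/- arXiv:2310.15927 — 7 statements merged into one kernel-verified Lean document; each statement's English description precedes it below -/
import Mathlib

section
/- Let $a_1,\ldots,a_k$ and $b_1,\ldots,b_l$ be positive integers ($k,l \geq 1$). Assume that no proper partial sums coincide, i.e., whenever $\sum_{i\in I}a_i=\sum_{j\in J}b_j$ for subsets $I\subseteq\{1,\ldots,k\}$ and $J\subseteq\{1,\ldots,l\}$, then either $I=J=\emptyset$, or $I=\{1,\ldots,k\}$ and $J=\{1,\ldots,l\}$. Then $\sum_{i=1}^k a_i+\sum_{j=1}^l b_j\geq 2(k+l-1)$. -/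
open Finset BigOperators

/-- `∑ aᵢ` plus the number of indices with `aᵢ = 1` is at least twice the number of terms. -/
theorem two_mul_card_le_sum_add_card_ones {ι : Type*} [Fintype ι] (a : ι → ℕ)
    (ha : ∀ i, 0 < a i) :
    2 * Fintype.card ι ≤ ∑ i, a i + #{i | a i = 1} := by
  rw [Finset.card_filter, ← Finset.sum_add_distrib, mul_comm, ← smul_eq_mul,
    ← Finset.card_univ, ← Finset.sum_const]
  refine Finset.sum_le_sum fun i _ => ?_
  have := ha i
  split_ifs <;> omega

/-- The bound when some `aᵢ` equals `1`: every `bⱼ` is at least the number of ones among the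
`aᵢ`, and strictly larger once there are two `bⱼ`. -/
theorem two_mul_card_add_card_le_of_exists_eq_one {ι κ : Type*} [Fintype ι] [Fintype κ]
    [Nonempty κ] (a : ι → ℕ) (b : κ → ℕ) (ha : ∀ i, 0 < a i)
    (h : ∀ (I : Finset ι) (J : Finset κ), ∑ i ∈ I, a i = ∑ j ∈ J, b j →
      (I = ∅ ∧ J = ∅) ∨ (I = Finset.univ ∧ J = Finset.univ))
    (hone : ∃ i, a i = 1) :
    2 * (Fintype.card ι + Fintype.card κ - 1) ≤ ∑ i, a i + ∑ j, b j := by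
  have hA := two_mul_card_le_sum_add_card_ones a ha
  set M : Finset ι := {i | a i = 1} with hM
  have hMpos : 0 < #M := by
    obtain ⟨i, hi⟩ := hone
    exact Finset.card_pos.2 ⟨i, by simp [hM, hi]⟩
  have hκ : 0 < Fintype.card κ := Fintype.card_pos
  have key : ∀ j, b j ≤ #M → b j = #M ∧ Fintype.card κ = 1 := by
    intro j hj
    obtain ⟨I, hIM, hIc⟩ := Finset.exists_subset_card_eq hj
    have hsum : ∑ i ∈ I, a i = ∑ j ∈ {j}, b j := by
      rw [Finset.sum_singleton, ← hIc, Finset.card_eq_sum_ones]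
      exact Finset.sum_congr rfl fun i hi => (Finset.mem_filter.1 (hIM hi)).2
    rcases h I {j} hsum with ⟨-, hJ⟩ | ⟨hI, hJ⟩
    · exact absurd hJ (Finset.singleton_ne_empty j)
    · refine ⟨?_, by rw [← Finset.card_univ, ← hJ, Finset.card_singleton]⟩
      exact le_antisymm hj (hIc ▸ hI ▸ Finset.card_le_univ M)
  have hB : 2 * (Fintype.card κ - 1) + #M ≤ ∑ j, b j := by
    rcases Nat.lt_or_ge 1 (Fintype.card κ) with hl | hl
    · have hlb : Fintype.card κ * (#M + 1) ≤ ∑ j, b j := by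
        rw [← Finset.card_univ, ← smul_eq_mul]
        refine Finset.card_nsmul_le_sum _ _ _ fun j _ => ?_
        by_contra hj
        have := (key j (by omega)).2
        omega
      obtain ⟨n, hn⟩ := Nat.exists_eq_add_of_lt hκ
      rw [hn] at hlb ⊢
      simp only [zero_add, Nat.add_sub_cancel] at hlb ⊢
      nlinarith
    · obtain ⟨j⟩ := ‹Nonempty κ›
      have hj : #M ≤ b j := by
        by_contra hj
        have := (key j (by omega)).1
        omega
      have := Finset.single_le_sum (fun i _ => Nat.zero_le (b i)) (Finset.mem_univ j)
      omega
  omega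

/-- If positive integers `a₁,…,a_k` and `b₁,…,b_l` have no coinciding proper
partial sums, then `∑ aᵢ + ∑ bⱼ ≥ 2(k+l-1)`. -/
theorem sum_ge_of_no_proper_partial_sum_coincidence
    (k l : ℕ) (hk : 1 ≤ k) (hl : 1 ≤ l)
    (a : Fin k → ℕ) (b : Fin l → ℕ)
    (ha : ∀ i, 0 < a i) (hb : ∀ j, 0 < b j)
    (hcoprime : ∀ (I : Finset (Fin k)) (J : Finset (Fin l)),
      ∑ i ∈ I, a i = ∑ j ∈ J, b j →
      (I = ∅ ∧ J = ∅) ∨ (I = Finset.univ ∧ J = Finset.univ)) :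
    2 * (k + l - 1) ≤ (∑ i, a i) + ∑ j, b j := by
  have : Nonempty (Fin k) := ⟨⟨0, hk⟩⟩
  have : Nonempty (Fin l) := ⟨⟨0, hl⟩⟩
  by_cases h1 : ∃ i, a i = 1
  · simpa using two_mul_card_add_card_le_of_exists_eq_one a b ha hcoprime h1
  by_cases h2 : ∃ j, b j = 1
  · have h := two_mul_card_add_card_le_of_exists_eq_one b a hb
      (fun J I hJI => (hcoprime I J hJI.symm).imp And.symm And.symm) h2
    simp only [Fintype.card_fin] at h
    omega
  have hA := two_mul_card_le_sum_add_card_ones a ha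
  have hB := two_mul_card_le_sum_add_card_ones b hb
  push Not at h1 h2
  simp only [h1, h2, Fintype.card_fin, Finset.filter_false, Finset.card_empty] at hA hB
  omega
end

section
/- Let $a_1,\ldots,a_k$ and $b_1,\ldots,b_l$ be positive integers ($k,l \geq 1$) such that no proper partial sums coincide. If equality holds in the inequality $\sum_{i=1}^k a_i+\sum_{j=1}^l b_j\geq 2(k+l-1)$, then either $l=1$ and $a_i=1$ for all $i\in\{1,\ldots,k\}$, or $k=1$ and $b_j=1$ for all $j\in\{1,\ldots,l\}$. -/
open Finset BigOperators

/-- Bounding a sum of positive integers below by counting the terms equal to `1`. -/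
lemma two_mul_card_le_sum_add_card_filter_eq_one {κ : Type*} [Fintype κ]
    (b : κ → ℕ) (hb : ∀ j, 0 < b j) :
    2 * Fintype.card κ ≤ ∑ j, b j + #{j | b j = 1} := by
  rw [card_filter, ← sum_add_distrib]
  calc 2 * Fintype.card κ = ∑ _j : κ, 2 := by simp [mul_comm]
    _ ≤ _ := sum_le_sum fun j _ => by
      have := hb j
      split_ifs <;> omega

/-- If some `b j` equals `1` and the total is small, then some `a i` is at most the number of ones
among the `b j`, so a set of ones sums to `a i`; hence there is only one `a i`, and all `b j`
are `1`. -/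
lemma card_eq_one_and_eq_one_of_exists_eq_one {ι κ : Type*} [Fintype ι] [Fintype κ] [Nonempty ι]
    (a : ι → ℕ) (b : κ → ℕ) (hb : ∀ j, 0 < b j)
    (hab : ∀ (I : Finset ι) (J : Finset κ), ∑ i ∈ I, a i = ∑ j ∈ J, b j →
      (I = ∅ ∧ J = ∅) ∨ (I = univ ∧ J = univ))
    (hsum : ∑ i, a i + ∑ j, b j + 2 ≤ 2 * (Fintype.card ι + Fintype.card κ))
    (hone : ∃ j, b j = 1) :
    Fintype.card ι = 1 ∧ ∀ j, b j = 1 := by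
  obtain ⟨j₀, hj₀⟩ := hone
  have hm : 0 < #{j | b j = 1} := card_pos.2 ⟨j₀, by simpa using hj₀⟩
  have hB := two_mul_card_le_sum_add_card_filter_eq_one b hb
  obtain ⟨i, hi⟩ : ∃ i, a i ≤ #{j | b j = 1} := by
    by_contra! h
    have hA : Fintype.card ι * (#{j | b j = 1} + 1) ≤ ∑ i, a i := by
      simpa using card_nsmul_le_sum univ a _ fun i _ => h i
    have hι : 0 < Fintype.card ι := Fintype.card_pos
    nlinarith
  obtain ⟨J, hJ, hcard⟩ := exists_subset_card_eq hi
  have hJone : ∀ j ∈ J, b j = 1 := fun j hj => (mem_filter.1 (hJ hj)).2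
  have hJsum : ∑ i ∈ {i}, a i = ∑ j ∈ J, b j := by
    rw [sum_singleton, sum_congr rfl hJone, ← card_eq_sum_ones, hcard]
  rcases hab {i} J hJsum with ⟨h, -⟩ | ⟨hI, hJ'⟩
  · exact absurd h (singleton_ne_empty i)
  · exact ⟨by rw [← card_univ, ← hI, card_singleton], fun j => hJone j (hJ' ▸ mem_univ j)⟩

/-- Equality case: if positive integers `a₁,…,a_k` and `b₁,…,b_l` have no
coinciding proper partial sums and `∑ aᵢ + ∑ bⱼ = 2(k+l-1)`, then either
`l = 1` and all `aᵢ = 1`, or `k = 1` and all `bⱼ = 1`. -/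
theorem eq_case_of_no_proper_partial_sum_coincidence
    (k l : ℕ) (hk : 1 ≤ k) (hl : 1 ≤ l)
    (a : Fin k → ℕ) (b : Fin l → ℕ)
    (ha : ∀ i, 0 < a i) (hb : ∀ j, 0 < b j)
    (hcoprime : ∀ (I : Finset (Fin k)) (J : Finset (Fin l)),
      ∑ i ∈ I, a i = ∑ j ∈ J, b j →
      (I = ∅ ∧ J = ∅) ∨ (I = Finset.univ ∧ J = Finset.univ))
    (heq : (∑ i, a i) + ∑ j, b j = 2 * (k + l - 1)) :
    (l = 1 ∧ ∀ i, a i = 1) ∨ (k = 1 ∧ ∀ j, b j = 1) := by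
  have : NeZero k := ⟨by omega⟩
  have : NeZero l := ⟨by omega⟩
  by_cases hb1 : ∃ j, b j = 1
  · right
    simpa using card_eq_one_and_eq_one_of_exists_eq_one a b hb hcoprime
      (by simp only [Fintype.card_fin]; omega) hb1
  by_cases ha1 : ∃ i, a i = 1
  · left
    simpa using card_eq_one_and_eq_one_of_exists_eq_one b a ha
      (fun J I h => (hcoprime I J h.symm).imp And.symm And.symm)
      (by simp only [Fintype.card_fin]; omega) ha1
  push Not at ha1 hb1
  have hA := two_mul_card_le_sum_add_card_filter_eq_one a ha
  have hB := two_mul_card_le_sum_add_card_filter_eq_one b hb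
  simp only [ha1, hb1, filter_false, card_empty, Fintype.card_fin] at hA hB
  omega
end

section
/- Let $a_1,\ldots,a_k$ and $b_1,\ldots,b_l$ be positive integers ($k,l \geq 1$) such that no proper partial sums coincide. For $0\leq i\leq k$ and $0\leq j\leq l$ define $d_{i,j}=a_1+\cdots+a_i-b_1-\cdots-b_j$. Then the set $\{d_{i,j} : 0\leq i\leq k,\ 0\leq j\leq l\}$ contains at least $(k+1)(l+1)-1$ distinct integers; equivalently, the assignment $(i,j)\mapsto d_{i,j}$ is injective on $\{0,\ldots,k\}\times\{0,\ldots,l\}$ with the possible sole exception of the pair of points $(0,0)$ and $(k,l)$. -/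
open Finset BigOperators

/-- A partial sum splits at an earlier index into a shorter partial sum and a block. -/
theorem partial_sum_eq_add_block {n : ℕ} (f : Fin n → ℤ) {i j : ℕ} (hij : i ≤ j) :
    (∑ t : Fin n, if (t : ℕ) < j then f t else 0) =
      (∑ t : Fin n, if (t : ℕ) < i then f t else 0) +
        ∑ t ∈ ({t : Fin n | i ≤ (t : ℕ) ∧ (t : ℕ) < j} : Finset (Fin n)), f t := by
  rw [Finset.sum_filter, ← Finset.sum_add_distrib]
  refine Finset.sum_congr rfl fun t _ => ?_
  split_ifs <;> omega

theorem eq_of_block_eq_empty {n i j : ℕ} (hij : i ≤ j) (hj : j ≤ n)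
    (h : ({t : Fin n | i ≤ (t : ℕ) ∧ (t : ℕ) < j} : Finset (Fin n)) = ∅) : i = j := by
  by_contra hne
  have hlt : i < n := by omega
  have hmem : (⟨i, hlt⟩ : Fin n) ∈
      ({t : Fin n | i ≤ (t : ℕ) ∧ (t : ℕ) < j} : Finset (Fin n)) := by
    simp only [Finset.mem_filter, Finset.mem_univ, true_and]
    omega
  simp [h] at hmem

theorem eq_zero_and_eq_of_block_eq_univ {n i j : ℕ} (hn : 1 ≤ n) (hj : j ≤ n)
    (h : ({t : Fin n | i ≤ (t : ℕ) ∧ (t : ℕ) < j} : Finset (Fin n)) = Finset.univ) :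
    i = 0 ∧ j = n := by
  rw [Finset.filter_eq_self] at h
  have h₀ := h ⟨0, hn⟩ (Finset.mem_univ _)
  have h₁ := h ⟨n - 1, by omega⟩ (Finset.mem_univ _)
  simp only at h₀ h₁
  omega

/-- Coinciding differences, for indices in the first coordinate that are ordered. -/
theorem eq_or_extreme_of_difference_eq {k l : ℕ} (hk : 1 ≤ k) (hl : 1 ≤ l)
    {a : Fin k → ℤ} {b : Fin l → ℤ} (ha : ∀ i, 0 < a i) (hb : ∀ j, 0 < b j)
    (hab : ∀ (I : Finset (Fin k)) (J : Finset (Fin l)),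
      ∑ i ∈ I, a i = ∑ j ∈ J, b j →
      (I = ∅ ∧ J = ∅) ∨ (I = Finset.univ ∧ J = Finset.univ))
    {i i' j j' : ℕ} (hii : i ≤ i') (hi' : i' ≤ k) (hj : j ≤ l) (hj' : j' ≤ l)
    (h : (∑ t : Fin k, if (t : ℕ) < i then a t else 0) -
        (∑ t : Fin l, if (t : ℕ) < j then b t else 0) =
      (∑ t : Fin k, if (t : ℕ) < i' then a t else 0) -
        (∑ t : Fin l, if (t : ℕ) < j' then b t else 0)) :
    (i = i' ∧ j = j') ∨ (i = 0 ∧ j = 0 ∧ i' = k ∧ j' = l) := by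
  rw [partial_sum_eq_add_block a hii] at h
  rcases le_or_gt j j' with hjj | hjj
  · rw [partial_sum_eq_add_block b hjj] at h
    rcases hab {t : Fin k | i ≤ (t : ℕ) ∧ (t : ℕ) < i'}
        {t : Fin l | j ≤ (t : ℕ) ∧ (t : ℕ) < j'} (by linarith) with ⟨hI, hJ⟩ | ⟨hI, hJ⟩
    · exact Or.inl ⟨eq_of_block_eq_empty hii hi' hI, eq_of_block_eq_empty hjj hj' hJ⟩
    · obtain ⟨h₁, h₂⟩ := eq_zero_and_eq_of_block_eq_univ hk hi' hI
      obtain ⟨h₃, h₄⟩ := eq_zero_and_eq_of_block_eq_univ hl hj' hJ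
      exact Or.inr ⟨h₁, h₃, h₂, h₄⟩
  · rw [partial_sum_eq_add_block b hjj.le] at h
    have hA : 0 ≤ ∑ t ∈ ({t : Fin k | i ≤ (t : ℕ) ∧ (t : ℕ) < i'} : Finset (Fin k)), a t :=
      Finset.sum_nonneg fun t _ => (ha t).le
    have hB : 0 < ∑ t ∈ ({t : Fin l | j' ≤ (t : ℕ) ∧ (t : ℕ) < j} : Finset (Fin l)), b t := by
      refine Finset.sum_pos (fun t _ => hb t) (Finset.nonempty_iff_ne_empty.mpr fun hJ => ?_)
      exact hjj.ne (eq_of_block_eq_empty hjj.le hj hJ)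
    linarith

/-- For positive integers `a₁,…,a_k`, `b₁,…,b_l` with no coinciding proper partial
sums, the differences `d i j = a₁+⋯+aᵢ - b₁-⋯-bⱼ` (for `0 ≤ i ≤ k`, `0 ≤ j ≤ l`)
take at least `(k+1)(l+1)-1` distinct values; equivalently, `(i,j) ↦ d i j` is
injective on `{0,…,k} × {0,…,l}` except possibly for the pair `(0,0)`, `(k,l)`. -/
theorem partial_sum_differences_distinct
    (k l : ℕ) (hk : 1 ≤ k) (hl : 1 ≤ l)
    (a : Fin k → ℤ) (b : Fin l → ℤ)
    (ha : ∀ i, 0 < a i) (hb : ∀ j, 0 < b j)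
    (hcoprime : ∀ (I : Finset (Fin k)) (J : Finset (Fin l)),
      ∑ i ∈ I, a i = ∑ j ∈ J, b j →
      (I = ∅ ∧ J = ∅) ∨ (I = Finset.univ ∧ J = Finset.univ))
    (d : ℕ → ℕ → ℤ)
    (hd : ∀ i j, d i j =
      (∑ t : Fin k, if (t : ℕ) < i then a t else 0) -
      (∑ t : Fin l, if (t : ℕ) < j then b t else 0)) :
    (k + 1) * (l + 1) - 1 ≤
      (((Finset.range (k + 1)) ×ˢ (Finset.range (l + 1))).image
        (fun p => d p.1 p.2)).card ∧
    ∀ i ≤ k, ∀ i' ≤ k, ∀ j ≤ l, ∀ j' ≤ l, d i j = d i' j' →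
      (i = i' ∧ j = j') ∨
      (i = 0 ∧ j = 0 ∧ i' = k ∧ j' = l) ∨
      (i = k ∧ j = l ∧ i' = 0 ∧ j' = 0) := by
  have hinj : ∀ i ≤ k, ∀ i' ≤ k, ∀ j ≤ l, ∀ j' ≤ l, d i j = d i' j' →
      (i = i' ∧ j = j') ∨
      (i = 0 ∧ j = 0 ∧ i' = k ∧ j' = l) ∨
      (i = k ∧ j = l ∧ i' = 0 ∧ j' = 0) := by
    intro i hi i' hi' j hj j' hj' h
    rw [hd, hd] at h
    rcases le_total i i' with hii | hii
    · have := eq_or_extreme_of_difference_eq hk hl ha hb hcoprime hii hi' hj hj' h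
      tauto
    · have := eq_or_extreme_of_difference_eq hk hl ha hb hcoprime hii hi hj' hj h.symm
      omega
  refine ⟨?_, hinj⟩
  have hmem : (k, l) ∈ Finset.range (k + 1) ×ˢ Finset.range (l + 1) := by simp
  have hcard : ((Finset.range (k + 1) ×ˢ Finset.range (l + 1)).erase (k, l)).card =
      (k + 1) * (l + 1) - 1 := by
    rw [Finset.card_erase_of_mem hmem, Finset.card_product, Finset.card_range,
      Finset.card_range]
  rw [← hcard, ← Finset.card_image_of_injOn (f := fun p : ℕ × ℕ => d p.1 p.2)]
  · exact Finset.card_le_card (Finset.image_subset_image (Finset.erase_subset _ _))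
  · rintro ⟨i, j⟩ hp ⟨i', j'⟩ hq h
    simp only [Finset.coe_erase, Set.mem_sdiff, Finset.mem_coe, Finset.mem_product,
      Finset.mem_range, Set.mem_singleton_iff, Prod.mk.injEq] at hp hq ⊢
    have := hinj i (by omega) i' (by omega) j (by omega) j' (by omega) h
    omega
end

section
/- Let $a_1,\ldots,a_k$ and $b_1,\ldots,b_l$ be positive integers ($k,l \geq 1$) such that no proper partial sums coincide. Then the stronger inequality $\sum_{i=1}^k a_i+\sum_{j=1}^l b_j\geq (k+1)(l+1)-2$ holds. -/
open Finset BigOperators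

/-- The sum of the entries of `a` with index in `[m, n)`. -/
def blockSum {k : ℕ} (a : Fin k → ℕ) (m n : ℕ) : ℕ :=
  ∑ i with m ≤ i.val ∧ i.val < n, a i

theorem blockSum_add {k : ℕ} (a : Fin k → ℕ) {m n p : ℕ} (hmn : m ≤ n) (hnp : n ≤ p) :
    blockSum a m n + blockSum a n p = blockSum a m p := by
  simp only [blockSum, Finset.sum_filter, ← Finset.sum_add_distrib]
  refine Finset.sum_congr rfl fun i _ => ?_
  split_ifs <;> omega

theorem blockSum_zero_self {k : ℕ} (a : Fin k → ℕ) : blockSum a 0 k = ∑ i, a i := by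
  simp [blockSum]

theorem blockSum_pos {k : ℕ} {a : Fin k → ℕ} (ha : ∀ i, 0 < a i) {m n : ℕ}
    (hmn : m < n) (hn : n ≤ k) : 0 < blockSum a m n :=
  Finset.sum_pos (fun i _ => ha i) ⟨⟨m, by omega⟩, by simp [hmn]⟩

theorem eq_of_block_eq_empty_s3 {k m n : ℕ} (hmn : m ≤ n) (hn : n ≤ k)
    (h : (Finset.univ.filter fun i : Fin k => m ≤ i.val ∧ i.val < n) = ∅) : m = n := by
  by_contra hne
  have hmem : (⟨m, by omega⟩ : Fin k) ∈
      Finset.univ.filter fun i : Fin k => m ≤ i.val ∧ i.val < n := by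
    simp only [Finset.mem_filter, Finset.mem_univ, true_and]
    omega
  simp [h] at hmem

theorem eq_zero_of_block_eq_univ {k m n : ℕ} (hk : 1 ≤ k)
    (h : (Finset.univ.filter fun i : Fin k => m ≤ i.val ∧ i.val < n) = Finset.univ) :
    m = 0 := by
  have hmem := Finset.mem_univ (⟨0, hk⟩ : Fin k)
  rw [← h] at hmem
  simpa using (Finset.mem_filter.mp hmem).2.1

/-- If positive integers `a₁,…,a_k` and `b₁,…,b_l` have no coinciding proper
partial sums, then the stronger inequality `∑ aᵢ + ∑ bⱼ ≥ (k+1)(l+1) - 2` holds. -/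
theorem sum_ge_product_of_no_proper_partial_sum_coincidence
    (k l : ℕ) (hk : 1 ≤ k) (hl : 1 ≤ l)
    (a : Fin k → ℕ) (b : Fin l → ℕ)
    (ha : ∀ i, 0 < a i) (hb : ∀ j, 0 < b j)
    (hcoprime : ∀ (I : Finset (Fin k)) (J : Finset (Fin l)),
      ∑ i ∈ I, a i = ∑ j ∈ J, b j →
      (I = ∅ ∧ J = ∅) ∨ (I = Finset.univ ∧ J = Finset.univ)) :
    (k + 1) * (l + 1) - 2 ≤ (∑ i, a i) + ∑ j, b j := by
  have key : ∀ i j i' j' : ℕ, i' ≤ i → i ≤ k → j ≤ l → j' ≤ l → (i', j') ≠ (0, 0) →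
      blockSum a 0 i + blockSum b j l = blockSum a 0 i' + blockSum b j' l →
      i = i' ∧ j = j' := by
    intro i j i' j' hi hik hjl hjl' hne heq
    have hP := blockSum_add a (Nat.zero_le i') hi
    rcases le_or_gt j' j with hj | hj
    · have hQ := blockSum_add b hj hjl
      rcases hcoprime _ _ (show blockSum a i' i = blockSum b j' j by omega) with
        ⟨hI, hJ⟩ | ⟨hI, hJ⟩
      · exact ⟨(eq_of_block_eq_empty_s3 hi hik hI).symm, (eq_of_block_eq_empty_s3 hj hjl hJ).symm⟩
      · exact absurd (Prod.ext (eq_zero_of_block_eq_univ hk hI)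
          (eq_zero_of_block_eq_univ hl hJ)) hne
    · have hQ := blockSum_add b hj.le hjl'
      have := blockSum_pos hb hj hjl'
      omega
  have hcard := Finset.card_le_card_of_injOn
    (s := (Finset.range (k + 1) ×ˢ Finset.range (l + 1)).erase (0, 0))
    (t := Finset.range ((∑ i, a i) + ∑ j, b j + 1))
    (fun p => blockSum a 0 p.1 + blockSum b p.2 l)
    (by
      rintro ⟨i, j⟩ hp
      simp only [Finset.mem_coe, Finset.mem_erase, Finset.mem_product,
        Finset.mem_range] at hp ⊢
      have hP := blockSum_add a (Nat.zero_le i) (show i ≤ k by omega)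
      have hQ := blockSum_add b (Nat.zero_le j) (show j ≤ l by omega)
      rw [blockSum_zero_self] at hP hQ
      omega)
    (by
      rintro ⟨i, j⟩ hp ⟨i', j'⟩ hp' heq
      simp only [Finset.mem_coe, Finset.mem_erase, Finset.mem_product,
        Finset.mem_range] at hp hp' heq
      rcases le_total i' i with h | h
      · obtain ⟨rfl, rfl⟩ := key i j i' j' h (by omega) (by omega) (by omega) hp'.1 heq
        rfl
      · obtain ⟨rfl, rfl⟩ := key i' j' i j h (by omega) (by omega) (by omega) hp.1 heq.symm
        rfl)
  rw [Finset.card_erase_of_mem (by simp), Finset.card_product] at hcard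
  simp only [Finset.card_range] at hcard
  omega
end

section
/- Let $Q_0$ be a nonempty finite set and $n : Q_0\times Q_0\to\mathbb{Z}_{\geq 0}$ a function (the number of arrows between vertices of a finite quiver). Define the Euler form $\langle{\bf d},{\bf e}\rangle=\sum_{i\in Q_0}d_ie_i-\sum_{i,j\in Q_0}n(i,j)\,d_ie_j$ on $\mathbb{Z}^{Q_0}$, its symmetrization $({\bf d},{\bf e})=\langle{\bf d},{\bf e}\rangle+\langle{\bf e},{\bf d}\rangle$, and its antisymmetrization $\{{\bf d},{\bf e}\}=\langle{\bf d},{\bf e}\rangle-\langle{\bf e},{\bf d}\rangle$. Let ${\bf d}\in\mathbb{Z}_{>0}^{Q_0}$ satisfy: (i) $\{{\bf d},{\bf e}\}\neq 0$ for every ${\bf e}\in\mathbb{Z}^{Q_0}$ with $0\leq e_i\leq d_i$ for all $i$, ${\bf e}\neq 0$, ${\bf e}\neq{\bf d}$ ($\{{\bf d},\_\}$-coprimality); (ii) $({\bf d},{\bf i})\leq -2$ for every coordinate vector ${\bf i}$, $i\in Q_0$. Then $1-\langle{\bf d},{\bf d}\rangle\geq(|Q_0|-1)\cdot\big(\gcd(\{{\bf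 d},{\bf i}\} : i\in Q_0)-1\big)$. -/
open Finset BigOperators

/-- The Euler form of a quiver with vertex set `Q0` and arrow-count function `n`:
`⟨d,e⟩ = ∑ᵢ dᵢeᵢ - ∑_{i,j} n(i,j) dᵢeⱼ`. -/
def eulerForm {Q0 : Type*} [Fintype Q0] (n : Q0 → Q0 → ℕ) (d e : Q0 → ℤ) : ℤ :=
  (∑ i, d i * e i) - ∑ i, ∑ j, (n i j : ℤ) * d i * e j

/-- The symmetrized Euler form `(d,e) = ⟨d,e⟩ + ⟨e,d⟩`. -/
def symForm {Q0 : Type*} [Fintype Q0] (n : Q0 → Q0 → ℕ) (d e : Q0 → ℤ) : ℤ :=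
  eulerForm n d e + eulerForm n e d

/-- The antisymmetrized Euler form `{d,e} = ⟨d,e⟩ - ⟨e,d⟩`. -/
def antiForm {Q0 : Type*} [Fintype Q0] (n : Q0 → Q0 → ℕ) (d e : Q0 → ℤ) : ℤ :=
  eulerForm n d e - eulerForm n e d

/-- The coordinate (indicator) vector of a vertex `i`. -/
def coordVec {Q0 : Type*} [DecidableEq Q0] (i : Q0) : Q0 → ℤ :=
  fun j => if j = i then 1 else 0

/-- `d` is `{d,_}`-coprime: `{d,e} ≠ 0` for all `e` with `0 ≤ e ≤ d`
componentwise, `e ≠ 0`, `e ≠ d`. -/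
def AntiCoprime {Q0 : Type*} [Fintype Q0] (n : Q0 → Q0 → ℕ) (d : Q0 → ℤ) : Prop :=
  ∀ e : Q0 → ℤ, (∀ i, 0 ≤ e i) → (∀ i, e i ≤ d i) → e ≠ 0 → e ≠ d →
    antiForm n d e ≠ 0

/-- A minimal zero-sum sequence of nonzero integers with values in `[-M, A]`, in which `t i` occurs
`d i` times, has length at most `A + M`. -/
theorem sum_le_add_of_minimal_zero_sum {ι : Type*} [Fintype ι] [DecidableEq ι]
    (d t : ι → ℤ) (ht : ∀ i, t i ≠ 0) (hd : 0 ≤ d)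
    (hsum : ∑ i, d i * t i = 0)
    (hmin : ∀ e : ι → ℤ, 0 ≤ e → e ≤ d → e ≠ 0 → e ≠ d → ∑ i, e i * t i ≠ 0)
    (A M : ℤ) (hA : ∀ i, t i ≤ A) (hM : ∀ i, -M ≤ t i) (hA0 : 0 ≤ A) (hM0 : 0 < M) :
    ∑ i, d i ≤ A + M := by
  have step : ∀ x : ι → ℤ, ∃ y : ι → ℤ,
      (0 ≤ x ∧ x ≤ d ∧ -M < ∑ i, x i * t i ∧ ∑ i, x i * t i ≤ A) → ∑ i, x i < ∑ i, d i →
      x ≤ y ∧ ∑ i, y i = ∑ i, x i + 1 ∧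
        (0 ≤ y ∧ y ≤ d ∧ -M < ∑ i, y i * t i ∧ ∑ i, y i * t i ≤ A) := by
    intro x
    by_cases hx : (0 ≤ x ∧ x ≤ d ∧ -M < ∑ i, x i * t i ∧ ∑ i, x i * t i ≤ A) ∧
      ∑ i, x i < ∑ i, d i
    swap
    · exact ⟨x, fun h1 h2 => absurd ⟨h1, h2⟩ hx⟩
    obtain ⟨⟨hx0, hxd, hlo, hhi⟩, hlt⟩ := hx
    have hrest : ∑ i, (d i - x i) * t i = -∑ i, x i * t i := by
      simp only [sub_mul, Finset.sum_sub_distrib, hsum, zero_sub]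
    have key : ∃ i, x i < d i ∧
        (∑ i, x i * t i ≤ 0 ∧ 0 < t i ∨ 0 < ∑ i, x i * t i ∧ t i < 0) := by
      by_contra! hno
      rcases le_or_gt (∑ i, x i * t i) 0 with hv | hv
      · obtain ⟨i, -, hi⟩ := Finset.exists_lt_of_sum_lt hlt
        have : ∑ i, (d i - x i) * t i < 0 := by
          refine Finset.sum_neg' (fun j _ => ?_) ⟨i, Finset.mem_univ _, ?_⟩
          · rcases (hxd j).eq_or_lt with h | h
            · simp [h]
            · exact mul_nonpos_of_nonneg_of_nonpos (by linarith) ((hno j h).1 hv)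
          · exact mul_neg_of_pos_of_neg (by linarith)
              (lt_of_le_of_ne ((hno i hi).1 hv) (ht i))
        linarith
      · have : 0 ≤ ∑ i, (d i - x i) * t i := by
          refine Finset.sum_nonneg fun j _ => ?_
          rcases (hxd j).eq_or_lt with h | h
          · simp [h]
          · exact mul_nonneg (by linarith) ((hno j h).2 hv)
        linarith
    obtain ⟨i, hi, hcase⟩ := key
    have hval : ∑ j, (x + Pi.single i 1 : ι → ℤ) j * t j = ∑ j, x j * t j + t i := by
      simp [add_mul, Finset.sum_add_distrib, Pi.single_apply]
    have hle : x ≤ x + Pi.single i 1 :=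
      le_add_of_nonneg_right (Pi.single_nonneg.2 zero_le_one)
    refine ⟨x + Pi.single i 1, fun _ _ => ⟨hle, ?_, hx0.trans hle, ?_, ?_, ?_⟩⟩
    · simp [Finset.sum_add_distrib]
    · intro j
      by_cases hj : j = i
      · subst hj
        simpa using hi
      · simpa [hj] using hxd j
    · rw [hval]
      have := hM i
      rcases hcase with h | h <;> linarith [h.1, h.2]
    · rw [hval]
      have := hA i
      rcases hcase with h | h <;> linarith [h.1, h.2]
  choose F hF using step
  set e : ℕ → ι → ℤ := fun k => F^[k] 0 with he
  have hsucc : ∀ k, e (k + 1) = F (e k) := fun k => Function.iterate_succ_apply' F k 0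
  have hgood : ∀ k : ℕ, (k : ℤ) ≤ ∑ i, d i → ∑ i, e k i = k ∧
      (0 ≤ e k ∧ e k ≤ d ∧ -M < ∑ i, e k i * t i ∧ ∑ i, e k i * t i ≤ A) := by
    intro k
    induction k with
    | zero =>
      intro _
      have h0 : e 0 = 0 := rfl
      rw [h0]
      simpa using ⟨hd, hM0, hA0⟩
    | succ k ih =>
      intro hk
      push_cast at hk
      obtain ⟨h1, h2⟩ := ih (by linarith)
      obtain ⟨-, h4, h5⟩ := hF (e k) h2 (by linarith)
      rw [hsucc]
      exact ⟨by rw [h4, h1]; push_cast; ring, h5⟩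
  have hmono : ∀ k l : ℕ, k ≤ l → (l : ℤ) ≤ ∑ i, d i → e k ≤ e l := by
    intro k l hkl
    induction l, hkl using Nat.le_induction with
    | base => exact fun _ => le_rfl
    | succ l _ ih =>
      intro hl
      push_cast at hl
      obtain ⟨h1, h2⟩ := hgood l (by linarith)
      refine (ih (by linarith)).trans ?_
      rw [hsucc]
      exact (hF (e l) h2 (by linarith)).1
  have hne : ∀ k l : ℕ, k < l → (l : ℤ) < ∑ i, d i →
      ∑ i, e k i * t i ≠ ∑ i, e l i * t i := by
    intro k l hkl hl heq
    obtain ⟨hk1, hk2, -⟩ := hgood k (by omega)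
    obtain ⟨hl1, -, hl3, -⟩ := hgood l hl.le
    have hs : ∑ i, (e l - e k) i = (l : ℤ) - k := by
      simp [Finset.sum_sub_distrib, hk1, hl1]
    refine hmin (e l - e k) (sub_nonneg.2 (hmono k l hkl.le hl.le))
      ((sub_le_self _ hk2).trans hl3) ?_ ?_ ?_
    · intro h
      rw [h] at hs
      simp at hs
      omega
    · intro h
      rw [h] at hs
      omega
    · simp [sub_mul, Finset.sum_sub_distrib, heq]
  have hD : 0 ≤ ∑ i, d i := Finset.sum_nonneg fun i _ => hd i
  have hcard : (Finset.range (∑ i, d i).toNat).card ≤ (Finset.Ioc (-M) A).card := by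
    refine Finset.card_le_card_of_injOn (fun k => ∑ i, e k i * t i) ?_ ?_
    · intro k hk
      simp only [Finset.coe_range, Set.mem_Iio] at hk
      have := (hgood k (by omega)).2.2.2
      simpa using this
    · intro k hk l hl hkl
      simp only [Finset.coe_range, Set.mem_Iio] at hk hl
      rcases lt_trichotomy k l with h | h | h
      · exact absurd hkl (hne k l h (by omega))
      · exact h
      · exact absurd hkl.symm (hne l k h (by omega))
  rw [Finset.card_range, Int.card_Ioc] at hcard
  omega

/-- The absolute values of the distinct entries of a minimal zero-sum sequence of integers over at
least two indices have sum at least `2 * (card ι - 1)`. -/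
theorem two_mul_card_sub_one_le_sum_abs {ι : Type*} [Fintype ι] [DecidableEq ι] [Nonempty ι]
    (d t : ι → ℤ) (hd : ∀ i, 0 < d i) (ht : ∀ i, t i ≠ 0)
    (hsum : ∑ i, d i * t i = 0)
    (hmin : ∀ e : ι → ℤ, 0 ≤ e → e ≤ d → e ≠ 0 → e ≠ d → ∑ i, e i * t i ≠ 0) :
    2 * ((Fintype.card ι : ℤ) - 1) ≤ ∑ i, |t i| := by
  obtain ⟨a, ha⟩ := Finite.exists_max t
  obtain ⟨b, hb⟩ := Finite.exists_min t
  have hapos : 0 < t a := by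
    by_contra! h
    have : ∑ i, d i * t i < 0 := Finset.sum_neg (fun i _ => mul_neg_of_pos_of_neg (hd i)
      (lt_of_le_of_ne ((ha i).trans h) (ht i))) Finset.univ_nonempty
    linarith
  have hbneg : t b < 0 := by
    by_contra! h
    have : 0 < ∑ i, d i * t i := Finset.sum_pos (fun i _ => mul_pos (hd i)
      (lt_of_le_of_ne (h.trans (hb i)) (ht i).symm)) Finset.univ_nonempty
    linarith
  have hab : a ≠ b := by
    rintro rfl
    linarith
  have hlen := sum_le_add_of_minimal_zero_sum d t ht (fun i => (hd i).le) hsum hmin (t a) (-t b)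
    ha (by simpa using hb) hapos.le (by linarith)
  have hcard : (Fintype.card ι : ℤ) ≤ ∑ i, d i := by
    calc (Fintype.card ι : ℤ) = ∑ _i : ι, (1 : ℤ) := by simp
      _ ≤ ∑ i, d i := Finset.sum_le_sum fun i _ => hd i
  have hexc : (|t a| - 1) + (|t b| - 1) ≤ ∑ i, (|t i| - 1) := by
    rw [← Finset.sum_pair (f := fun i => |t i| - 1) hab]
    refine Finset.sum_le_sum_of_subset_of_nonneg (Finset.subset_univ _) fun i _ _ => ?_
    have := Int.one_le_abs (ht i)
    linarith
  rw [abs_of_pos hapos, abs_of_neg hbneg, Finset.sum_sub_distrib] at hexc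
  simp at hexc
  linarith

theorem eulerForm_coordVec {Q0 : Type*} [Fintype Q0] [DecidableEq Q0]
    (n : Q0 → Q0 → ℕ) (d : Q0 → ℤ) (i : Q0) :
    eulerForm n d (coordVec i) = d i - ∑ j, (n j i : ℤ) * d j := by
  simp [eulerForm, coordVec]

theorem coordVec_eulerForm {Q0 : Type*} [Fintype Q0] [DecidableEq Q0]
    (n : Q0 → Q0 → ℕ) (d : Q0 → ℤ) (i : Q0) :
    eulerForm n (coordVec i) d = d i - ∑ j, (n i j : ℤ) * d j := by
  simp [eulerForm, coordVec]

theorem eulerForm_eq_sum_right {Q0 : Type*} [Fintype Q0] [DecidableEq Q0]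
    (n : Q0 → Q0 → ℕ) (d e : Q0 → ℤ) :
    eulerForm n d e = ∑ i, e i * eulerForm n d (coordVec i) := by
  simp only [eulerForm_coordVec, mul_sub, Finset.sum_sub_distrib, Finset.mul_sum]
  rw [eulerForm, Finset.sum_comm]
  congr 1
  · exact Finset.sum_congr rfl fun i _ => mul_comm _ _
  · exact Finset.sum_congr rfl fun i _ => Finset.sum_congr rfl fun j _ => by ring

theorem eulerForm_eq_sum_left {Q0 : Type*} [Fintype Q0] [DecidableEq Q0]
    (n : Q0 → Q0 → ℕ) (d e : Q0 → ℤ) :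
    eulerForm n e d = ∑ i, e i * eulerForm n (coordVec i) d := by
  simp only [coordVec_eulerForm, mul_sub, Finset.sum_sub_distrib, Finset.mul_sum]
  rw [eulerForm]
  congr 1
  exact Finset.sum_congr rfl fun i _ => Finset.sum_congr rfl fun j _ => by ring

theorem antiForm_eq_sum {Q0 : Type*} [Fintype Q0] [DecidableEq Q0]
    (n : Q0 → Q0 → ℕ) (d e : Q0 → ℤ) :
    antiForm n d e = ∑ i, e i * antiForm n d (coordVec i) := by
  rw [antiForm, eulerForm_eq_sum_right, eulerForm_eq_sum_left, ← Finset.sum_sub_distrib]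
  exact Finset.sum_congr rfl fun i _ => by rw [antiForm]; ring

theorem symForm_eq_sum {Q0 : Type*} [Fintype Q0] [DecidableEq Q0]
    (n : Q0 → Q0 → ℕ) (d e : Q0 → ℤ) :
    symForm n d e = ∑ i, e i * symForm n d (coordVec i) := by
  rw [symForm, eulerForm_eq_sum_right, eulerForm_eq_sum_left, ← Finset.sum_add_distrib]
  exact Finset.sum_congr rfl fun i _ => by rw [symForm]; ring

theorem abs_antiForm_coordVec_le {Q0 : Type*} [Fintype Q0] [DecidableEq Q0]
    (n : Q0 → Q0 → ℕ) (d : Q0 → ℤ) (hd : ∀ i, 0 < d i) (i : Q0) :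
    |antiForm n d (coordVec i)| ≤ 2 * d i - symForm n d (coordVec i) := by
  rw [antiForm, symForm, eulerForm_coordVec, coordVec_eulerForm]
  have h1 : 0 ≤ ∑ j, (n j i : ℤ) * d j :=
    Finset.sum_nonneg fun j _ => mul_nonneg (Int.natCast_nonneg _) (hd j).le
  have h2 : 0 ≤ ∑ j, (n i j : ℤ) * d j :=
    Finset.sum_nonneg fun j _ => mul_nonneg (Int.natCast_nonneg _) (hd j).le
  rw [abs_le]
  constructor <;> linarith

theorem abs_antiForm_coordVec_sub_two_le {Q0 : Type*} [Fintype Q0] [DecidableEq Q0]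
    (n : Q0 → Q0 → ℕ) (d : Q0 → ℤ) (hd : ∀ i, 0 < d i) (i : Q0)
    (hfund : symForm n d (coordVec i) ≤ -2) :
    |antiForm n d (coordVec i)| - 2 ≤ -(d i * symForm n d (coordVec i)) := by
  have h := abs_antiForm_coordVec_le n d hd i
  have hdi : 1 ≤ d i := hd i
  rcases le_total (|antiForm n d (coordVec i)|) (2 * d i + 2) with hle | hle
  · nlinarith
  · nlinarith [mul_nonneg (sub_nonneg.2 hdi) (sub_nonneg.2 hle)]

/-- For a dimension vector `d > 0` which is `{d,_}`-coprime and satisfies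
`(d,i) ≤ -2` for every coordinate vector, one has
`1 - ⟨d,d⟩ ≥ (|Q0|-1)·(gcd({d,i} : i) - 1)`. -/
theorem mukai_inequality_for_quiver_moduli
    {Q0 : Type*} [Fintype Q0] [DecidableEq Q0] [Nonempty Q0]
    (n : Q0 → Q0 → ℕ) (d : Q0 → ℤ)
    (hd : ∀ i, 0 < d i)
    (hcoprime : AntiCoprime n d)
    (hfund : ∀ i : Q0, symForm n d (coordVec i) ≤ -2) :
    ((Fintype.card Q0 : ℤ) - 1) *
        ((Finset.univ.gcd fun i : Q0 => antiForm n d (coordVec i)) - 1) ≤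
      1 - eulerForm n d d := by
  have hself : 2 * eulerForm n d d = ∑ i, d i * symForm n d (coordVec i) := by
    rw [← symForm_eq_sum, symForm, two_mul]
  rcases subsingleton_or_nontrivial Q0 with hQ | hQ
  · have hcard : Fintype.card Q0 = 1 :=
      le_antisymm (Fintype.card_le_one_iff_subsingleton.2 hQ) Fintype.card_pos
    have : ∑ i, d i * symForm n d (coordVec i) ≤ 0 := Finset.sum_nonpos fun i _ =>
      mul_nonpos_of_nonneg_of_nonpos (hd i).le ((hfund i).trans (by norm_num))
    rw [hcard]
    push_cast
    linarith
  have hne : ∀ i, antiForm n d (coordVec i) ≠ 0 := by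
    intro i
    refine hcoprime _ (fun j => ?_) (fun j => ?_) (fun h => ?_) (fun h => ?_)
    · unfold coordVec
      split_ifs <;> norm_num
    · have := hd j
      unfold coordVec
      split_ifs <;> omega
    · simpa [coordVec] using congrFun h i
    · obtain ⟨j, hj⟩ := exists_ne i
      have h1 := congrFun h j
      have := hd j
      simp [coordVec, hj] at h1
      omega
  set g : ℤ := Finset.univ.gcd fun i : Q0 => antiForm n d (coordVec i) with hg
  have hdvd : ∀ i, g ∣ antiForm n d (coordVec i) := fun i =>
    Finset.gcd_dvd (Finset.mem_univ i)
  choose t ht using hdvd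
  have hg0 : 0 ≤ g := Int.nonneg_of_normalize_eq_self Finset.normalize_gcd
  have hgne : g ≠ 0 := by
    intro h
    obtain ⟨i⟩ := ‹Nonempty Q0›
    exact hne i (by rw [ht, h, zero_mul])
  have hval : ∀ e : Q0 → ℤ, antiForm n d e = g * ∑ i, e i * t i := by
    intro e
    rw [antiForm_eq_sum, Finset.mul_sum]
    exact Finset.sum_congr rfl fun i _ => by rw [ht]; ring
  have hmain : 2 * ((Fintype.card Q0 : ℤ) - 1) ≤ ∑ i, |t i| := by
    refine two_mul_card_sub_one_le_sum_abs d t hd (fun i h => ?_) ?_ fun e h0 h1 h2 h3 h => ?_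
    · exact hne i (by rw [ht, h, mul_zero])
    · have h := hval d
      rw [antiForm, sub_self] at h
      exact (mul_eq_zero.1 h.symm).resolve_left hgne
    · exact hcoprime e h0 h1 h2 h3 (by rw [hval, h, mul_zero])
  have habs : ∑ i, |antiForm n d (coordVec i)| = g * ∑ i, |t i| := by
    rw [Finset.mul_sum]
    exact Finset.sum_congr rfl fun i _ => by rw [ht, abs_mul, abs_of_nonneg hg0]
  have hbound : ∑ i, (|antiForm n d (coordVec i)| - 2) ≤
      ∑ i, -(d i * symForm n d (coordVec i)) :=
    Finset.sum_le_sum fun i _ => abs_antiForm_coordVec_sub_two_le n d hd i (hfund i)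
  rw [Finset.sum_sub_distrib, Finset.sum_neg_distrib, habs, ← hself] at hbound
  simp at hbound
  nlinarith [mul_le_mul_of_nonneg_left hmain hg0]
end

section
/- Let $Q_0$ be a nonempty finite set, $n : Q_0\times Q_0\to\mathbb{Z}_{\geq 0}$ an arrow-count function with Euler form $\langle\cdot,\cdot\rangle$, symmetrization $(\cdot,\cdot)$, and antisymmetrization $\{\cdot,\cdot\}$, and let ${\bf d}\in\mathbb{Z}_{>0}^{Q_0}$ be $\{{\bf d},\_\}$-coprime and satisfy $({\bf d},{\bf i})\leq -2$ for all $i\in Q_0$. Set $m=\gcd(\{{\bf d},{\bf i}\} : i\in Q_0)$. If equality $1-\langle{\bf d},{\bf d}\rangle=(|Q_0|-1)\cdot(m-1)$ holds, then $d_i=1$ for all $i\in Q_0$, and there exists a vertex $i_0\in Q_0$ such that either (a) $n(i,i_0)=m$ for all $i\neq i_0$ and $n(i,j)=0$ whenever $j\neq i_0$, or (b) $n(i_0,j)=m$ for all $j\neq i_0$ and $n(i,j)=0$ whenever $i\neq i_0$; that is, $Q$ is the $m$-thickened $(|Q_0|-1)$-subspace quiver or its opposite, and ${\bf d}$ is thin.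 -/
open Finset BigOperators

section Forms

variable {Q0 : Type*} [Fintype Q0] (n : Q0 → Q0 → ℕ) (d : Q0 → ℤ)

/-- The number of arrows leaving the vertex `i`, weighted by `d` at their targets. -/
def outDegree (i : Q0) : ℤ := ∑ j, (n i j : ℤ) * d j

/-- The number of arrows entering the vertex `i`, weighted by `d` at their sources. -/
def inDegree (i : Q0) : ℤ := ∑ j, (n j i : ℤ) * d j

variable {n d}

lemma outDegree_nonneg (hd : ∀ i, 0 < d i) (i : Q0) : 0 ≤ outDegree n d i :=
  Finset.sum_nonneg fun j _ => mul_nonneg (Int.natCast_nonneg _) (hd j).le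

lemma inDegree_nonneg (hd : ∀ i, 0 < d i) (i : Q0) : 0 ≤ inDegree n d i :=
  Finset.sum_nonneg fun j _ => mul_nonneg (Int.natCast_nonneg _) (hd j).le

lemma arrows_eq_zero_of_outDegree (hd : ∀ i, 0 < d i) {i : Q0} (h : outDegree n d i = 0)
    (j : Q0) : n i j = 0 := by
  have h' := (Finset.sum_eq_zero_iff_of_nonneg
    fun j _ => mul_nonneg (Int.natCast_nonneg (n i j)) (hd j).le).1 h j (Finset.mem_univ j)
  simpa [(hd j).ne'] using h'

lemma arrows_eq_zero_of_inDegree (hd : ∀ i, 0 < d i) {i : Q0} (h : inDegree n d i = 0)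
    (j : Q0) : n j i = 0 := by
  have h' := (Finset.sum_eq_zero_iff_of_nonneg
    fun j _ => mul_nonneg (Int.natCast_nonneg (n j i)) (hd j).le).1 h j (Finset.mem_univ j)
  simpa [(hd j).ne'] using h'

variable (n d)

lemma eulerForm_right_eq (e : Q0 → ℤ) :
    eulerForm n d e = ∑ i, e i * (d i - inDegree n d i) := by
  unfold eulerForm inDegree
  rw [Finset.sum_comm, ← Finset.sum_sub_distrib]
  refine Finset.sum_congr rfl fun i _ => ?_
  rw [mul_sub, Finset.mul_sum]
  congr 1
  · ring
  · exact Finset.sum_congr rfl fun j _ => by ring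

lemma eulerForm_left_eq (e : Q0 → ℤ) :
    eulerForm n e d = ∑ i, e i * (d i - outDegree n d i) := by
  unfold eulerForm outDegree
  rw [← Finset.sum_sub_distrib]
  refine Finset.sum_congr rfl fun i _ => ?_
  rw [mul_sub, Finset.mul_sum]
  congr 1
  exact Finset.sum_congr rfl fun j _ => by ring

lemma antiForm_eq (e : Q0 → ℤ) :
    antiForm n d e = ∑ i, e i * (outDegree n d i - inDegree n d i) := by
  rw [antiForm, eulerForm_right_eq, eulerForm_left_eq, ← Finset.sum_sub_distrib]
  exact Finset.sum_congr rfl fun i _ => by ring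

lemma symForm_eq (e : Q0 → ℤ) :
    symForm n d e = ∑ i, e i * (2 * d i - (outDegree n d i + inDegree n d i)) := by
  rw [symForm, eulerForm_right_eq, eulerForm_left_eq, ← Finset.sum_add_distrib]
  exact Finset.sum_congr rfl fun i _ => by ring

lemma two_mul_eulerForm_self :
    2 * eulerForm n d d = ∑ i, d i * (2 * d i - (outDegree n d i + inDegree n d i)) := by
  rw [← symForm_eq, symForm, two_mul]

variable [DecidableEq Q0]

lemma sum_coordVec_mul (i : Q0) (f : Q0 → ℤ) : ∑ j, coordVec i j * f j = f i := by
  simp [coordVec]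

end Forms

section ZeroSum

variable {Q0 : Type*} [Fintype Q0]

/-- `d`, viewed as the sequence in which `y i` is repeated `d i` times, has no proper nonempty
zero-sum subsequence. -/
def HasNoProperZeroSum (d y : Q0 → ℤ) : Prop :=
  ∀ e : Q0 → ℤ, 0 ≤ e → e ≤ d → e ≠ 0 → e ≠ d → ∑ i, e i * y i ≠ 0

/-- A subsequence that is not the whole sequence can be extended by an element which moves its
sum towards zero. -/
lemma exists_balancing_index {d y e : Q0 → ℤ} (hy : ∀ i, y i ≠ 0)
    (hsum : ∑ i, d i * y i = 0) (hed : e ≤ d) (hne : e ≠ d) :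
    ∃ i, e i < d i ∧ (0 < ∑ j, e j * y j → y i < 0) ∧ (∑ j, e j * y j ≤ 0 → 0 < y i) := by
  have hdiff : ∑ i, (d i - e i) * y i = - ∑ i, e i * y i := by
    simp only [sub_mul, Finset.sum_sub_distrib, hsum, zero_sub]
  by_cases hs : 0 < ∑ j, e j * y j
  · obtain ⟨i, -, hi⟩ : ∃ i ∈ Finset.univ, (d i - e i) * y i < 0 := by
      by_contra! h
      linarith [Finset.sum_nonneg h]
    have := hed i
    refine ⟨i, ?_, fun _ => ?_, fun h => absurd hs h.not_gt⟩
    · rcases this.lt_or_eq with h | h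
      · exact h
      · simp [h] at hi
    · by_contra! h
      exact hi.not_ge (mul_nonneg (sub_nonneg.2 this) h)
  · obtain ⟨i, -, hi⟩ : ∃ i ∈ Finset.univ, 0 < (d i - e i) * y i := by
      by_contra! h
      have h0 : ∑ i, (d i - e i) * y i = 0 := le_antisymm (Finset.sum_nonpos h) (by linarith)
      refine hne (funext fun i => ?_)
      have := (Finset.sum_eq_zero_iff_of_nonpos h).1 h0 i (Finset.mem_univ i)
      have := (mul_eq_zero.1 this).resolve_right (hy i)
      linarith
    have := hed i
    refine ⟨i, ?_, fun h => absurd h hs, fun _ => ?_⟩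
    · rcases this.lt_or_eq with h | h
      · exact h
      · simp [h] at hi
    · exact pos_of_mul_pos_right hi (sub_nonneg.2 this)

/-- Ordering a minimal zero-sum sequence greedily, its partial sums stay in `(-B, A]` and are
pairwise distinct. -/
lemma exists_partial_sums [DecidableEq Q0] {d y : Q0 → ℤ} (hd : 0 ≤ d) (hy : ∀ i, y i ≠ 0)
    (hsum : ∑ i, d i * y i = 0) (hmin : HasNoProperZeroSum d y) {A B : ℤ}
    (hA0 : 0 ≤ A) (hB0 : 0 < B) (hA : ∀ i, y i ≤ A) (hB : ∀ i, -B ≤ y i) (k : ℕ)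
    (hk : (k : ℤ) ≤ ∑ i, d i) :
    ∃ e : Q0 → ℤ, 0 ≤ e ∧ e ≤ d ∧ ∑ i, e i = k ∧ ∑ i, e i * y i ∈ Finset.Ioc (-B) A ∧
      ∃ V ⊆ Finset.Ioc (-B) A, V.card = k ∧
        ∀ v ∈ V, ∃ e' : Q0 → ℤ, 0 ≤ e' ∧ e' ≤ e ∧ e' ≠ e ∧ ∑ i, e' i * y i = v := by
  induction k with
  | zero => exact ⟨0, le_rfl, hd, by simp, by simp [hA0, hB0], ∅, by simp, by simp, by simp⟩
  | succ k ih =>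
    push_cast at hk
    obtain ⟨e, he0, hed, hek, hs, V, hV, hVk, hVe⟩ := ih (by linarith)
    have hne : e ≠ d := by
      rintro rfl
      linarith
    obtain ⟨i, hi, hneg, hpos⟩ := exists_balancing_index hy hsum hed hne
    have hc0 : (0 : Q0 → ℤ) ≤ coordVec i := fun j => by
      simp only [coordVec, Pi.zero_apply]
      split_ifs <;> simp
    have hsum' : ∑ j, (e + coordVec i) j * y j = ∑ j, e j * y j + y i := by
      simp only [Pi.add_apply, add_mul, Finset.sum_add_distrib, sum_coordVec_mul]
    have hnotMem : ∑ j, e j * y j ∉ V := by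
      intro hmem
      obtain ⟨e', he'0, he'e, he'ne, he's⟩ := hVe _ hmem
      refine hmin (e - e') (sub_nonneg.2 he'e) ?_ (sub_ne_zero.2 he'ne.symm) ?_ ?_
      · exact (sub_le_self e he'0).trans hed
      · intro h
        exact hne (le_antisymm hed (h ▸ sub_le_self e he'0))
      · simp only [Pi.sub_apply, sub_mul, Finset.sum_sub_distrib, he's, sub_self]
    refine ⟨e + coordVec i, add_nonneg he0 hc0, fun j => ?_, ?_, ?_,
      insert (∑ j, e j * y j) V, ?_, ?_, ?_⟩
    · have := hed j
      simp only [Pi.add_apply, coordVec]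
      split_ifs with hj
      · subst hj
        linarith
      · simpa using this
    · simp [Finset.sum_add_distrib, hek, coordVec]
    · rw [hsum']
      rw [Finset.mem_Ioc] at hs ⊢
      have := hA i
      have := hB i
      rcases lt_or_ge 0 (∑ j, e j * y j) with h | h
      · have := hneg h
        constructor <;> linarith
      · have := hpos h
        constructor <;> linarith
    · exact Finset.insert_subset hs hV
    · rw [Finset.card_insert_of_notMem hnotMem, hVk]
    · have hlt : e ≠ e + coordVec i := fun h => by
        have := congrFun h i
        simp [coordVec] at this
      have hle : e ≤ e + coordVec i := le_add_of_nonneg_right hc0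
      intro v hv
      rcases Finset.mem_insert.1 hv with rfl | hv
      · exact ⟨e, he0, hle, hlt, rfl⟩
      · obtain ⟨e', he'0, he'e, he'ne, he's⟩ := hVe v hv
        refine ⟨e', he'0, he'e.trans hle, ?_, he's⟩
        rintro rfl
        exact hlt (le_antisymm hle he'e)

/-- A minimal zero-sum sequence of nonzero integers in `[-B, A]` has length at most `A + B`. -/
lemma HasNoProperZeroSum.length_le [DecidableEq Q0] {d y : Q0 → ℤ} (hmin : HasNoProperZeroSum d y)
    (hd : 0 ≤ d) (hy : ∀ i, y i ≠ 0) (hsum : ∑ i, d i * y i = 0) {A B : ℤ}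
    (hA0 : 0 ≤ A) (hB0 : 0 < B) (hA : ∀ i, y i ≤ A) (hB : ∀ i, -B ≤ y i) :
    ∑ i, d i ≤ A + B := by
  have hN : (((∑ i, d i).toNat : ℕ) : ℤ) = ∑ i, d i :=
    Int.toNat_of_nonneg (Finset.sum_nonneg fun i _ => hd i)
  obtain ⟨-, -, -, -, -, V, hV, hcard, -⟩ :=
    exists_partial_sums hd hy hsum hmin hA0 hB0 hA hB _ hN.le
  have := Finset.card_le_card hV
  rw [hcard, Int.card_Ioc] at this
  omega

end ZeroSum

section Classification

variable {Q0 : Type*} [Fintype Q0] [DecidableEq Q0] {y : Q0 → ℤ} {i₁ i₂ : Q0}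

lemma exists_unit_of_extremal (hne : i₁ ≠ i₂) (h₁ : 0 < y i₁) (h₂ : y i₂ < 0)
    (hy : ∀ i, y i ≠ 0)
    (habs : ∀ i, |y i| = 1 + (y i₁ - 1) * coordVec i₁ i + (-y i₂ - 1) * coordVec i₂ i)
    (hsum : ∑ i, y i = 0) (hcard : y i₁ - y i₂ = Fintype.card Q0) (hB : y i₂ ≠ -1) :
    ∃ i, i ≠ i₁ ∧ y i = 1 := by
  by_contra! h
  have hle : ∀ i ∈ Finset.univ, y i + |y i| ≤ 2 * y i₁ * coordVec i₁ i := by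
    intro i _
    by_cases hi : i = i₁
    · subst hi
      simp [coordVec, abs_of_pos h₁]
      linarith
    · have hneg : y i < 0 := by
        refine lt_of_le_of_ne (not_lt.1 fun hpos => ?_) (hy i)
        have hi2 : i ≠ i₂ := by
          rintro rfl
          linarith
        have := habs i
        rw [abs_of_pos hpos] at this
        simp [coordVec, hi, hi2] at this
        exact h i hi this
      simp [coordVec, hi, abs_of_neg hneg]
  have := Finset.sum_le_sum hle
  rw [Finset.sum_add_distrib, hsum] at this
  simp only [habs] at this
  simp [Finset.sum_add_distrib, coordVec] at this
  omega

lemma star_of_extremal_unit (h₁ : ∀ i, y i ≤ y i₁) (hu : y i₁ = 1)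
    (hsum : ∑ i, y i = 0) (hcard : y i₁ - y i₂ = Fintype.card Q0) :
    ∀ i, i ≠ i₂ → y i = 1 := by
  have hle : ∀ i ∈ Finset.univ, y i ≤ 1 + (y i₂ - 1) * coordVec i₂ i := by
    intro i _
    by_cases hi : i = i₂
    · simp [coordVec, hi]
    · simpa [coordVec, hi, hu] using h₁ i
  have heq : ∑ i, y i = ∑ i, (1 + (y i₂ - 1) * coordVec i₂ i) := by
    rw [hsum]
    simp [Finset.sum_add_distrib, coordVec]
    omega
  intro i hi
  simpa [coordVec, hi] using (Finset.sum_eq_sum_iff_of_le hle).1 heq i (Finset.mem_univ i)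

/-- Extremal thin minimal zero-sum sequences are `(1, …, 1, -(r - 1))` up to sign. -/
lemma star_of_extremal (hmin : HasNoProperZeroSum (fun _ => 1) y)
    (hmax₁ : ∀ i, y i ≤ y i₁) (hmin₂ : ∀ i, y i₂ ≤ y i)
    (hne : i₁ ≠ i₂) (h₁ : 0 < y i₁) (h₂ : y i₂ < 0) (hy : ∀ i, y i ≠ 0)
    (habs : ∀ i, |y i| = 1 + (y i₁ - 1) * coordVec i₁ i + (-y i₂ - 1) * coordVec i₂ i)
    (hsum : ∑ i, y i = 0) (hcard : y i₁ - y i₂ = Fintype.card Q0) :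
    (∀ i, i ≠ i₂ → y i = 1) ∨ (∀ i, i ≠ i₁ → y i = -1) := by
  have hsum' : ∑ i, (-y) i = 0 := by simp [hsum]
  by_cases hA : y i₁ = 1
  · exact .inl (star_of_extremal_unit hmax₁ hA hsum hcard)
  by_cases hB : y i₂ = -1
  · refine .inr fun i hi => ?_
    have := star_of_extremal_unit (y := -y) (i₁ := i₂) (i₂ := i₁) (by simpa using hmin₂)
      (by simp [hB]) hsum' (by simp; linarith) i hi
    simp at this
    linarith
  exfalso
  obtain ⟨i, hi, hyi⟩ := exists_unit_of_extremal hne h₁ h₂ hy habs hsum hcard hB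
  obtain ⟨j, hj, hyj⟩ := exists_unit_of_extremal (y := -y) (i₁ := i₂) (i₂ := i₁) hne.symm
    (by simpa using h₂) (by simpa using h₁) (by simpa using hy)
    (fun i => by simp [habs i]; ring) hsum' (by simp; linarith) (by simpa using hA)
  have hyj' : y j = -1 := by
    simp at hyj
    linarith
  have hij : i ≠ j := by
    rintro rfl
    linarith
  have hji : i₁ ≠ j := by
    rintro rfl
    linarith
  refine hmin (coordVec i + coordVec j) (fun k => ?_) (fun k => ?_) (fun h => ?_) (fun h => ?_) ?_
  · simp only [coordVec, Pi.add_apply, Pi.zero_apply]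
    split_ifs <;> simp
  · simp only [coordVec, Pi.add_apply]
    split_ifs with hki hkj
    · exact absurd (hki.symm.trans hkj) hij
    all_goals simp
  · simpa [coordVec, hij] using congrFun h i
  · simpa [coordVec, hi.symm, hji] using congrFun h i₁
  · simp only [Pi.add_apply, add_mul, Finset.sum_add_distrib, sum_coordVec_mul, hyi, hyj']
    norm_num

end Classification

/-- Equality case of the Mukai inequality for quiver moduli: if
`1 - ⟨d,d⟩ = (|Q0|-1)·(m-1)` with `m = gcd({d,i} : i)`, then `d` is thin and `Q`
is the `m`-thickened `(|Q0|-1)`-subspace quiver or its opposite. -/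
theorem mukai_equality_case_for_quiver_moduli
    {Q0 : Type*} [Fintype Q0] [DecidableEq Q0] [Nonempty Q0]
    (n : Q0 → Q0 → ℕ) (d : Q0 → ℤ)
    (hd : ∀ i, 0 < d i)
    (hcoprime : AntiCoprime n d)
    (hfund : ∀ i : Q0, symForm n d (coordVec i) ≤ -2)
    (m : ℤ) (hm : m = Finset.univ.gcd fun i : Q0 => antiForm n d (coordVec i))
    (heq : 1 - eulerForm n d d = ((Fintype.card Q0 : ℤ) - 1) * (m - 1)) :
    (∀ i, d i = 1) ∧
    ∃ i0 : Q0,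
      ((∀ i, i ≠ i0 → (n i i0 : ℤ) = m) ∧ (∀ i j, j ≠ i0 → n i j = 0)) ∨
      ((∀ j, j ≠ i0 → (n i0 j : ℤ) = m) ∧ (∀ i j, i ≠ i0 → n i j = 0)) := by
  have hcard0 : 0 < Fintype.card Q0 := Fintype.card_pos
  set o := outDegree n d with ho
  set p := inDegree n d with hp
  have hx : ∀ i, antiForm n d (coordVec i) = o i - p i := fun i => by
    rw [antiForm_eq, sum_coordVec_mul]
  have hfund' : ∀ i, 2 * d i + 2 ≤ o i + p i := fun i => by
    have := hfund i
    rw [symForm_eq, sum_coordVec_mul] at this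
    linarith
  have hdeg : ∑ i, d i * (o i + p i - 2 * d i) = 2 * ((Fintype.card Q0 : ℤ) - 1) * (m - 1) - 2 := by
    have h2 := two_mul_eulerForm_self n d
    have h3 : ∑ i, d i * (o i + p i - 2 * d i) = -(2 * eulerForm n d d) := by
      rw [h2, ← Finset.sum_neg_distrib]
      exact Finset.sum_congr rfl fun i _ => by ring
    rw [h3]
    linarith
  have hterm : ∀ i, 2 ≤ d i * (o i + p i - 2 * d i) := fun i => by
    nlinarith [hd i, hfund' i]
  have hnontriv : Fintype.card Q0 ≠ 1 := by
    intro h1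
    rw [h1] at hdeg
    have := Finset.sum_nonneg fun i (_ : i ∈ Finset.univ) => zero_le_two.trans (hterm i)
    rw [hdeg] at this
    norm_num at this
  have : Nontrivial Q0 := Fintype.one_lt_card_iff_nontrivial.1 (by omega)
  have hanti : ∑ i, d i * (o i - p i) = 0 := by
    rw [← antiForm_eq, antiForm, sub_self]
  have hx0 : ∀ i, o i - p i ≠ 0 := by
    intro i
    rw [← hx]
    refine hcoprime _ (fun j => ?_) (fun j => ?_) (fun h => ?_) (fun h => ?_)
    · simp only [coordVec]
      split_ifs <;> simp
    · have := hd j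
      simp only [coordVec]
      split_ifs <;> omega
    · simpa [coordVec] using congrFun h i
    · obtain ⟨j, hj⟩ := exists_ne i
      have h1 := congrFun h j
      have h2 := hd j
      simp [coordVec, hj] at h1
      omega
  have hdvd : ∀ i, ∃ t, o i - p i = m * t := fun i => by
    rw [← hx, hm]
    exact Finset.gcd_dvd (f := fun i => antiForm n d (coordVec i)) (Finset.mem_univ i)
  choose y hy using hdvd
  have hm0 : 0 < m := by
    have h1 : 0 ≤ m := by
      rw [hm, ← Finset.normalize_gcd]
      exact Int.nonneg_of_normalize_eq_self (normalize_idem _)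
    refine lt_of_le_of_ne h1 fun h => ?_
    obtain ⟨i⟩ := ‹Nonempty Q0›
    exact hx0 i (by rw [hy, ← h, zero_mul])
  have hy0 : ∀ i, y i ≠ 0 := fun i h => hx0 i (by rw [hy, h, mul_zero])
  have hfactor : ∀ e : Q0 → ℤ, ∑ i, e i * (o i - p i) = m * ∑ i, e i * y i := fun e => by
    rw [Finset.mul_sum]
    exact Finset.sum_congr rfl fun i _ => by rw [hy]; ring
  have hysum : ∑ i, d i * y i = 0 := by
    rw [hfactor] at hanti
    exact (mul_eq_zero.1 hanti).resolve_left hm0.ne'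
  have hmin : HasNoProperZeroSum d y := by
    intro e h0 h1 h2 h3 h4
    refine hcoprime e h0 h1 h2 h3 ?_
    rw [antiForm_eq, hfactor, h4, mul_zero]
  obtain ⟨i₁, hi₁⟩ := Finite.exists_max y
  obtain ⟨i₂, hi₂⟩ := Finite.exists_min y
  have h₁ : 0 < y i₁ := by
    by_contra! h
    have hneg : ∀ i ∈ Finset.univ, d i * y i < 0 := fun i _ =>
      mul_neg_of_pos_of_neg (hd i) (lt_of_le_of_ne ((hi₁ i).trans h) (hy0 i))
    exact (Finset.sum_neg hneg Finset.univ_nonempty).ne hysum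
  have h₂ : y i₂ < 0 := by
    by_contra! h
    have hpos : ∀ i ∈ Finset.univ, 0 < d i * y i := fun i _ =>
      mul_pos (hd i) (lt_of_le_of_ne (h.trans (hi₂ i)) (hy0 i).symm)
    exact (Finset.sum_pos hpos Finset.univ_nonempty).ne' hysum
  have hne : i₁ ≠ i₂ := by
    intro h
    rw [h] at h₁
    linarith
  have hlen : ∑ i, d i ≤ y i₁ + -y i₂ :=
    hmin.length_le (fun i => (hd i).le) hy0 hysum h₁.le (by linarith) hi₁ (by simpa using hi₂)
  have hone : ∀ i ∈ Finset.univ, (1 : ℤ) ≤ d i := fun i _ => hd i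
  have hcardle := Finset.sum_le_sum hone
  have hable : ∀ i ∈ Finset.univ,
      1 + (y i₁ - 1) * coordVec i₁ i + (-y i₂ - 1) * coordVec i₂ i ≤ |y i| := by
    intro i _
    simp only [coordVec]
    split_ifs with h h' h'
    · exact absurd (h.symm.trans h') hne
    · rw [h]
      linarith [le_abs_self (y i₁)]
    · rw [h']
      linarith [neg_abs_le (y i₂)]
    · have := abs_pos.2 (hy0 i)
      linarith
  have habsle := Finset.sum_le_sum hable
  have hcoord : ∑ i, (1 + (y i₁ - 1) * coordVec i₁ i + (-y i₂ - 1) * coordVec i₂ i)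
      = (Fintype.card Q0 : ℤ) + (y i₁ - 1) + (-y i₂ - 1) := by
    simp [Finset.sum_add_distrib, coordVec]
  have hxabs : ∀ i, m * |y i| ≤ o i + p i := fun i => by
    have h3 := outDegree_nonneg (n := n) hd i
    have h4 := inDegree_nonneg (n := n) hd i
    rw [← abs_of_pos hm0, ← abs_mul, ← hy, abs_le]
    constructor <;> linarith
  have hvertex : ∀ i ∈ Finset.univ, m * |y i| - 2 ≤ d i * (o i + p i - 2 * d i) := by
    intro i _
    nlinarith [mul_nonneg (sub_nonneg.2 (hone i (Finset.mem_univ i)))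
      (sub_nonneg.2 (hfund' i)), hxabs i]
  have hvertexle := Finset.sum_le_sum hvertex
  have hsumleft : ∑ i, (m * |y i| - 2) = m * ∑ i, |y i| - 2 * (Fintype.card Q0 : ℤ) := by
    rw [Finset.sum_sub_distrib, ← Finset.mul_sum]
    simp
    ring
  simp only [Finset.sum_const, Finset.card_univ, nsmul_eq_mul, mul_one] at hcardle
  rw [hcoord] at habsle
  rw [hsumleft, hdeg] at hvertexle
  have habsum : ∑ i, |y i| ≤ 2 * ((Fintype.card Q0 : ℤ) - 1) := by
    refine le_of_mul_le_mul_left ?_ hm0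
    linarith
  have hcardeq : y i₁ - y i₂ = Fintype.card Q0 := by linarith
  have hd1 : ∀ i, d i = 1 := by
    have h : ∑ i : Q0, (1 : ℤ) = ∑ i, d i := by
      simp
      linarith
    exact fun i => ((Finset.sum_eq_sum_iff_of_le hone).1 h i (Finset.mem_univ i)).symm
  have habs : ∀ i, |y i| = 1 + (y i₁ - 1) * coordVec i₁ i + (-y i₂ - 1) * coordVec i₂ i := by
    have h := hcoord.trans (show _ = ∑ i, |y i| by linarith)
    exact fun i => ((Finset.sum_eq_sum_iff_of_le hable).1 h i (Finset.mem_univ i)).symm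
  have hdegeq : ∀ i, o i + p i = m * |y i| := by
    have h5 : ∑ i, |y i| = 2 * ((Fintype.card Q0 : ℤ) - 1) := by linarith
    have h : ∑ i, (m * |y i| - 2) = ∑ i, d i * (o i + p i - 2 * d i) := by
      rw [hsumleft, hdeg, h5]
      ring
    intro i
    have := (Finset.sum_eq_sum_iff_of_le hvertex).1 h i (Finset.mem_univ i)
    rw [hd1] at this
    linarith
  have hout : ∀ i, y i < 0 → ∀ j, n i j = 0 := by
    intro i hi
    refine arrows_eq_zero_of_outDegree hd ?_
    have h6 := hdegeq i
    rw [abs_of_neg hi] at h6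
    linarith [hy i]
  have hin : ∀ i, 0 < y i → ∀ j, n j i = 0 := by
    intro i hi
    refine arrows_eq_zero_of_inDegree hd ?_
    have h6 := hdegeq i
    rw [abs_of_pos hi] at h6
    linarith [hy i]
  have hd1' : d = fun _ => 1 := funext hd1
  have hysum1 : ∑ i, y i = 0 := by simpa [hd1] using hysum
  refine ⟨hd1, ?_⟩
  rcases star_of_extremal (hd1' ▸ hmin) hi₁ hi₂ hne h₁ h₂ hy0 habs hysum1 hcardeq with hs | hs
  · have hzero : ∀ i j, j ≠ i₂ → n i j = 0 := fun i j hj => hin j (by simp [hs j hj]) i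
    refine ⟨i₂, .inl ⟨fun i hi => ?_, hzero⟩⟩
    have h7 : o i = n i i₂ := by
      rw [ho, outDegree, Finset.sum_eq_single i₂ (fun j _ hj => by simp [hzero i j hj]) (by simp),
        hd1, mul_one]
    have h8 := hdegeq i
    have h9 := hy i
    rw [hs i hi] at h8 h9
    norm_num at h8
    linarith
  · have hzero : ∀ i j, i ≠ i₁ → n i j = 0 := fun i j hi => hout i (by simp [hs i hi]) j
    refine ⟨i₁, .inr ⟨fun j hj => ?_, hzero⟩⟩
    have h7 : p j = n i₁ j := by
      rw [hp, inDegree, Finset.sum_eq_single i₁ (fun i _ hi => by simp [hzero i j hi]) (by simp),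
        hd1, mul_one]
    have h8 := hdegeq j
    have h9 := hy j
    rw [hs j hj] at h8 h9
    norm_num at h8
    linarith
end

section
/- Let $Q_0$ be a nonempty finite set, $n : Q_0\times Q_0\to\mathbb{Z}_{\geq 0}$ an arrow-count function with Euler form $\langle\cdot,\cdot\rangle$, symmetrization $(\cdot,\cdot)$, and antisymmetrization $\{\cdot,\cdot\}$. Let ${\bf d}\in\mathbb{Z}_{>0}^{Q_0}$ satisfy $({\bf d},{\bf i})\leq -2$ for all $i\in Q_0$, and set $m=\gcd(\{{\bf d},{\bf i}\}:i\in Q_0)$, $\alpha_i=d_i-\langle{\bf i},{\bf d}\rangle$, $\beta_i=d_i-\langle{\bf d},{\bf i}\rangle$. If $\sum_{i\in Q_0}(\alpha_i+\beta_i)\geq 2(|Q_0|-1)\cdot m$, then $1-\langle{\bf d},{\bf d}\rangle\geq(|Q_0|-1)\cdot(m-1)$. -/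
open Finset BigOperators

theorem sum_mul_eulerForm_coordVec_right {Q0 : Type*} [Fintype Q0] [DecidableEq Q0]
    (n : Q0 → Q0 → ℕ) (d e : Q0 → ℤ) :
    ∑ i, e i * eulerForm n d (coordVec i) = eulerForm n d e := by
  simp only [eulerForm, coordVec, mul_ite, mul_one, mul_zero,
    Finset.sum_ite_eq', Finset.mem_univ, if_true, mul_sub, Finset.sum_sub_distrib, Finset.mul_sum]
  congr 1
  · exact Finset.sum_congr rfl fun i _ => mul_comm _ _
  · rw [Finset.sum_comm]
    simp [mul_comm]

theorem sum_mul_eulerForm_coordVec_left {Q0 : Type*} [Fintype Q0] [DecidableEq Q0]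
    (n : Q0 → Q0 → ℕ) (d e : Q0 → ℤ) :
    ∑ i, d i * eulerForm n (coordVec i) e = eulerForm n d e := by
  simp only [eulerForm, coordVec, mul_ite, ite_mul, mul_one, mul_zero, one_mul, zero_mul,
    Finset.sum_ite_irrel, Finset.sum_const_zero,
    Finset.sum_ite_eq', Finset.mem_univ, if_true, mul_sub, Finset.sum_sub_distrib, Finset.mul_sum]
  congr 1
  exact Finset.sum_congr rfl fun i _ => Finset.sum_congr rfl fun j _ => by ring

/-- If `d > 0` satisfies `(d,i) ≤ -2` for all vertices and
`∑ᵢ (αᵢ + βᵢ) ≥ 2(|Q0|-1)·m` where `m = gcd({d,i} : i)`, `αᵢ = dᵢ - ⟨i,d⟩`,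
`βᵢ = dᵢ - ⟨d,i⟩`, then `1 - ⟨d,d⟩ ≥ (|Q0|-1)·(m-1)`. -/
theorem mukai_inequality_of_alpha_beta_sum
    {Q0 : Type*} [Fintype Q0] [DecidableEq Q0] [Nonempty Q0]
    (n : Q0 → Q0 → ℕ) (d : Q0 → ℤ)
    (hd : ∀ i, 0 < d i)
    (hfund : ∀ i : Q0, symForm n d (coordVec i) ≤ -2)
    (m : ℤ) (hm : m = Finset.univ.gcd fun i : Q0 => antiForm n d (coordVec i))
    (α β : Q0 → ℤ)
    (hα : ∀ i, α i = d i - eulerForm n (coordVec i) d)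
    (hβ : ∀ i, β i = d i - eulerForm n d (coordVec i))
    (hsum : 2 * ((Fintype.card Q0 : ℤ) - 1) * m ≤ ∑ i, (α i + β i)) :
    ((Fintype.card Q0 : ℤ) - 1) * (m - 1) ≤ 1 - eulerForm n d d := by
  have hdd : ∑ i, d i * symForm n d (coordVec i) = 2 * eulerForm n d d := by
    simp only [symForm, mul_add, Finset.sum_add_distrib, sum_mul_eulerForm_coordVec_right,
      sum_mul_eulerForm_coordVec_left]
    ring
  have hle : ∑ i, (α i + β i) ≤ ∑ i, (2 - d i * symForm n d (coordVec i)) := by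
    refine Finset.sum_le_sum fun i _ => ?_
    have hs := hfund i
    have hαβ : α i + β i = 2 * d i - symForm n d (coordVec i) := by
      rw [hα, hβ, symForm]
      ring
    nlinarith [mul_nonneg (sub_nonneg.2 (hd i)) (sub_nonneg.2 hs)]
  rw [Finset.sum_sub_distrib, hdd, Finset.sum_const, Finset.card_univ, nsmul_eq_mul] at hle
  linarith
end
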